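/- Let w ∈ ℝ^m with w ≠ 0, b ∈ ℝ, and x ∈ ℝ^m with ⟨w, x⟩ + b ≠ 0. Let p ∈ [1, ∞] and let q be the Hölder conjugate of p. Then the set {‖δ‖_p : δ ∈ ℝ^m, sign(⟨w, x + δ⟩ + b) ≠ sign(⟨w, x⟩ + b)} has a minimum, and this minimum equals |⟨w, x⟩ + b| / ‖w‖_q. -/

import Mathlib

open scoped ENNReal

/-- The `ℓ_p` norm of a vector in `ℝ^m`. -/
noncomputable def lpNorm {m : ℕ} (p : ℝ≥0∞) [Fact (1 ≤ p)] (v : Fin m → ℝ) : ℝ :=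
  ‖(WithLp.equiv p (Fin m → ℝ)).symm v‖

section lpNorm

variable {m : ℕ} {p q : ℝ≥0∞}

theorem lpNorm_one [Fact (1 ≤ (1 : ℝ≥0∞))] (v : Fin m → ℝ) : lpNorm 1 v = ∑ i, |v i| :=
  PiLp.norm_eq_of_L1 _

theorem lpNorm_eq_sum [Fact (1 ≤ p)] (hp : p ≠ ∞) (v : Fin m → ℝ) :
    lpNorm p v = (∑ i, |v i| ^ p.toReal) ^ (1 / p.toReal) :=
  PiLp.norm_eq_sum (ENNReal.toReal_pos (zero_lt_one.trans_le Fact.out).ne' hp) _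

theorem abs_apply_le_lpNorm [Fact (1 ≤ p)] (v : Fin m → ℝ) (i : Fin m) : |v i| ≤ lpNorm p v :=
  PiLp.norm_apply_le (WithLp.toLp p v) i

theorem lpNorm_pos [Fact (1 ≤ p)] {v : Fin m → ℝ} (hv : v ≠ 0) : 0 < lpNorm p v := by
  obtain ⟨i, hi⟩ := Function.ne_iff.mp hv
  exact (abs_pos.mpr hi).trans_le (abs_apply_le_lpNorm v i)

theorem lpNorm_smul [Fact (1 ≤ p)] (c : ℝ) (v : Fin m → ℝ) :
    lpNorm p (c • v) = |c| * lpNorm p v :=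
  norm_smul c (WithLp.toLp p v)

theorem lpNorm_top_le [Fact (1 ≤ ∞)] {v : Fin m → ℝ} {C : ℝ} (hC : 0 ≤ C)
    (h : ∀ i, |v i| ≤ C) : lpNorm ∞ v ≤ C :=
  (PiLp.norm_eq_ciSup (WithLp.toLp ∞ v)).trans_le (Real.iSup_le h hC)

theorem abs_sum_mul_le_lpNorm_one_mul_lpNorm_top [Fact (1 ≤ (1 : ℝ≥0∞))] [Fact (1 ≤ ∞)]
    (v w : Fin m → ℝ) : |∑ i, v i * w i| ≤ lpNorm 1 v * lpNorm ∞ w := by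
  rw [lpNorm_one, Finset.sum_mul]
  refine (Finset.abs_sum_le_sum_abs _ _).trans (Finset.sum_le_sum fun i _ => ?_)
  rw [abs_mul]
  gcongr
  exact abs_apply_le_lpNorm w i

/-- **Hölder's inequality** for finite sums, including the endpoint exponents. -/
theorem abs_sum_mul_le_lpNorm_mul_lpNorm [Fact (1 ≤ p)] [Fact (1 ≤ q)] [p.HolderConjugate q]
    (v w : Fin m → ℝ) : |∑ i, v i * w i| ≤ lpNorm p v * lpNorm q w := by
  by_cases hp : p = ∞
  · subst hp
    obtain rfl : q = 1 := (ENNReal.HolderConjugate.eq_top_iff_eq_one ∞ q).mp rfl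
    simpa only [mul_comm] using abs_sum_mul_le_lpNorm_one_mul_lpNorm_top w v
  by_cases hq : q = ∞
  · subst hq
    obtain rfl : p = 1 := (ENNReal.HolderConjugate.eq_top_iff_eq_one ∞ p).mp rfl
    exact abs_sum_mul_le_lpNorm_one_mul_lpNorm_top v w
  rw [lpNorm_eq_sum hp, lpNorm_eq_sum hq]
  refine (Finset.abs_sum_le_sum_abs _ _).trans ?_
  simp only [abs_mul]
  exact Real.inner_le_Lp_mul_Lq_of_nonneg _ (ENNReal.HolderConjugate.toReal_of_ne_top hp hq)
    (fun _ _ => abs_nonneg _) (fun _ _ => abs_nonneg _)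

theorem abs_sign_le_one (x : ℝ) : |(SignType.sign x : ℝ)| ≤ 1 := by
  cases SignType.sign x <;> simp

/-- The `ℓ_q` norm is attained as a dual norm on the `ℓ_p` unit ball. -/
theorem exists_lpNorm_le_one_sum_mul_eq [Fact (1 ≤ p)] [Fact (1 ≤ q)] [p.HolderConjugate q]
    {w : Fin m → ℝ} (hw : w ≠ 0) :
    ∃ v : Fin m → ℝ, lpNorm p v ≤ 1 ∧ ∑ i, w i * v i = lpNorm q w := by
  by_cases hp : p = ∞
  · subst hp
    obtain rfl : q = 1 := (ENNReal.HolderConjugate.eq_top_iff_eq_one ∞ q).mp rfl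
    refine ⟨fun i => SignType.sign (w i),
      lpNorm_top_le zero_le_one fun i => abs_sign_le_one _, ?_⟩
    simp only [lpNorm_one, self_mul_sign]
  by_cases hq : q = ∞
  · subst hq
    obtain rfl : p = 1 := (ENNReal.HolderConjugate.eq_top_iff_eq_one ∞ p).mp rfl
    obtain ⟨j, -⟩ := Function.ne_iff.mp hw
    have : Nonempty (Fin m) := ⟨j⟩
    obtain ⟨i, hi⟩ := Finite.exists_max fun i => |w i|
    refine ⟨Pi.single i (SignType.sign (w i) : ℝ), ?_, ?_⟩
    · simpa [lpNorm_one, Pi.single_apply, apply_ite] using abs_sign_le_one (w i)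
    · simpa [Pi.single_apply] using
        le_antisymm (abs_apply_le_lpNorm w i) (lpNorm_top_le (abs_nonneg _) hi)
  have hqp := (ENNReal.HolderConjugate.toReal_of_ne_top hp hq).symm
  obtain ⟨g, hg, hgw⟩ := (NNReal.isGreatest_Lp Finset.univ (fun i => ‖w i‖₊) hqp).1
  refine ⟨fun i => SignType.sign (w i) * g i, ?_, ?_⟩
  · rw [lpNorm_eq_sum hp]
    refine Real.rpow_le_one (by positivity) ?_ (by positivity)
    calc ∑ i, |(SignType.sign (w i) * g i : ℝ)| ^ p.toReal ≤ ∑ i, (g i : ℝ) ^ p.toReal := by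
          gcongr with i
          rw [abs_mul, NNReal.abs_eq]
          exact mul_le_of_le_one_left (g i).2 (abs_sign_le_one _)
      _ ≤ 1 := by exact_mod_cast hg
  · rw [lpNorm_eq_sum hq]
    simp only [← mul_assoc, self_mul_sign]
    simpa using congrArg NNReal.toReal hgw

end lpNorm

theorem Real.sign_add_eq_of_abs_lt {c s : ℝ} (h : |s| < |c|) :
    Real.sign (c + s) = Real.sign c := by
  rcases lt_or_ge c 0 with hc | hc
  · rw [abs_of_neg hc, abs_lt] at h
    rw [Real.sign_of_neg hc, Real.sign_of_neg (by linarith)]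
  · rw [abs_of_nonneg hc, abs_lt] at h
    rw [Real.sign_of_pos (by linarith : 0 < c), Real.sign_of_pos (by linarith)]

/-- For a linear classifier `x ↦ sign(⟨w, x⟩ + b)` with `w ≠ 0` and a point `x` with
`⟨w, x⟩ + b ≠ 0`, the set of `ℓ_p` norms of perturbations `δ` flipping the sign has a
minimum, equal to `|⟨w, x⟩ + b| / ‖w‖_q`, where `q` is the Hölder conjugate of `p`. -/
theorem min_adversarial_perturbation_norm {m : ℕ}
    (w : Fin m → ℝ) (hw : w ≠ 0) (b : ℝ) (x : Fin m → ℝ)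
    (hx : ∑ i, w i * x i + b ≠ 0)
    (p q : ℝ≥0∞) [Fact (1 ≤ p)] [Fact (1 ≤ q)] (hpq : p⁻¹ + q⁻¹ = 1) :
    IsLeast {r : ℝ | ∃ δ : Fin m → ℝ, r = lpNorm p δ ∧
        Real.sign (∑ i, w i * (x i + δ i) + b) ≠ Real.sign (∑ i, w i * x i + b)}
      (|∑ i, w i * x i + b| / lpNorm q w) := by
  have : p.HolderConjugate q := ENNReal.holderConjugate_iff.mpr hpq
  have hN : 0 < lpNorm q w := lpNorm_pos hw
  have hsum (δ : Fin m → ℝ) :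
      ∑ i, w i * (x i + δ i) + b = (∑ i, w i * x i + b) + ∑ i, w i * δ i := by
    simp only [mul_add, Finset.sum_add_distrib]
    ring
  simp only [hsum]
  set c := ∑ i, w i * x i + b
  have lower {δ : Fin m → ℝ} (h : |c| ≤ |∑ i, w i * δ i|) :
      |c| / lpNorm q w ≤ lpNorm p δ := by
    rw [div_le_iff₀' hN]
    exact h.trans (abs_sum_mul_le_lpNorm_mul_lpNorm w δ)
  constructor
  · obtain ⟨v, hv, hvw⟩ := exists_lpNorm_le_one_sum_mul_eq (p := p) (q := q) hw
    have hδ : ∑ i, w i * ((-c / lpNorm q w) • v) i = -c := by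
      simp only [Pi.smul_apply, smul_eq_mul, mul_left_comm (w _), ← Finset.mul_sum, hvw]
      exact div_mul_cancel₀ _ hN.ne'
    refine ⟨(-c / lpNorm q w) • v, le_antisymm (lower (by rw [hδ, abs_neg])) ?_, ?_⟩
    · rw [lpNorm_smul, abs_div, abs_neg, abs_of_pos hN]
      exact mul_le_of_le_one_right (by positivity) hv
    · rw [hδ, add_neg_cancel, Real.sign_zero]
      exact fun h => hx (Real.sign_eq_zero_iff.mp h.symm)
  · rintro _ ⟨δ, rfl, hδ⟩
    exact lower (not_lt.mp fun h => hδ (Real.sign_add_eq_of_abs_lt h))
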